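/- arXiv:math/9903026 — 2 statements merged into one kernel-verified Lean document; each statement's English description precedes it below -/
import Mathlib

section
/- Let F = (p,q) : ℝ² → ℝ² be Pinchuk's map and let C = Φ(ℝ) ⊆ ℝ² where Φ(s) = (s² + 2s, u(s² + s, s)). Then the preimage F⁻¹(C) is a smooth curve (a 1-dimensional smooth submanifold of ℝ²) having exactly three connected components. -/
noncomputable section

/-- The Pinchuk auxiliary polynomial `t = xy - 1`. -/
def pT (x y : ℝ) : ℝ := x * y - 1

/-- The Pinchuk auxiliary polynomial `h = t(xt + 1)`. -/
def pH (x y : ℝ) : ℝ := pT x y * (x * pT x y + 1)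

/-- The Pinchuk auxiliary polynomial `f = (xt+1)^2 (t^2 + y)`. -/
def pF (x y : ℝ) : ℝ := (x * pT x y + 1) ^ 2 * ((pT x y) ^ 2 + y)

/-- The Pinchuk polynomial `u(f,h)`. -/
def pU (f h : ℝ) : ℝ :=
  (1/4) * f * (75*f^3 + 300*f^2*h + 450*f*h^2 + 276*f^2 + 828*f*h + 48*h^2 + 364*f + 48*h)

/-- Pinchuk's map `F = (p, q) : ℝ² → ℝ²` with `p = f + h` and
    `q = -t² - 6th(h+1) + u(f,h)`. -/
def pinchuk : ℝ × ℝ → ℝ × ℝ := fun v =>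
  (pF v.1 v.2 + pH v.1 v.2,
   -(pT v.1 v.2)^2 - 6 * pT v.1 v.2 * pH v.1 v.2 * (pH v.1 v.2 + 1)
     + pU (pF v.1 v.2) (pH v.1 v.2))

/-- The parameterization `Φ(s) = (s² + 2s, u(s² + s, s))`. -/
def Phi (s : ℝ) : ℝ × ℝ := (s^2 + 2*s, pU (s^2 + s) s)

/-- A continuous map `g : X → Y` is *not proper at* `y ∈ Y` if there is no
    neighborhood `U` of `y` such that `g ⁻¹(cl U)` is compact. -/
def NotProperAt {X Y : Type*} [TopologicalSpace X] [TopologicalSpace Y]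
    (g : X → Y) (y : Y) : Prop :=
  ¬ ∃ U ∈ nhds y, IsCompact (g ⁻¹' closure U)

/-- `S` is, near `p`, a smooth curve (a 1-dimensional smooth submanifold of `ℝ²`):
    locally it is the regular zero set of a smooth real-valued function. -/
def IsSmoothCurveAt (S : Set (ℝ × ℝ)) (p : ℝ × ℝ) : Prop :=
  ∃ U : Set (ℝ × ℝ), IsOpen U ∧ p ∈ U ∧
    ∃ g : ℝ × ℝ → ℝ, ContDiff ℝ (⊤ : ℕ∞) g ∧ (∀ q ∈ U, fderiv ℝ g q ≠ 0) ∧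
      S ∩ U = {q ∈ U | g q = 0}

/-- The part of the second coordinate of `Phi` that is even in `s + 1`, as a function of the
first coordinate. -/
def phiEven (p : ℝ) : ℝ :=
  (1/4) * (75*p^4 + 276*p^3 + 364*p^2 + 680*p + 316*(p + 2) - 780*p*(p + 2)
    - 504*(3*(p + 1) + 1) + 300*p*(3*(p + 1) + 1) + 225*((p + 1)^2 + 6*(p + 1) + 1))

/-- The part of the second coordinate of `Phi` that is odd in `s + 1`, divided by `s + 1`, as a
function of the first coordinate. -/
def phiOdd (p : ℝ) : ℝ := -((p + 1) * (75*(p + 1) + 29))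

lemma Phi_snd_eq (s : ℝ) :
    (Phi s).2 = phiEven (s^2 + 2*s) + (s + 1) * phiOdd (s^2 + 2*s) := by
  simp only [Phi, pU, phiEven, phiOdd]; ring

lemma phiOdd_neg {s : ℝ} (hs : s ≠ -1) : phiOdd (s^2 + 2*s) < 0 := by
  have h : 0 < (s + 1)^2 := by
    have : s + 1 ≠ 0 := fun h => hs (by linarith)
    positivity
  have e : phiOdd (s^2 + 2*s) = -((s + 1)^2 * (75*(s + 1)^2 + 29)) := by
    simp only [phiOdd]; ring
  rw [e]
  have : 0 < (s + 1)^2 * (75*(s + 1)^2 + 29) := by positivity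
  linarith

/-- The value of `t` in terms of `c = f + h` and `f`. -/
def levelT (c f : ℝ) : ℝ := (c - f) - (c - f)^2 * (c - f + 1) / f

/-- The value of the second coordinate of Pinchuk's map in terms of `c = f + h` and `f`. -/
def levelQ (c f : ℝ) : ℝ :=
  -(levelT c f)^2 - 6 * levelT c f * (c - f) * (c - f + 1) + pU f (c - f)

/-- The value of `f - h - h ^ 2` in terms of `c = f + h` and `f`. -/
def levelD (c f : ℝ) : ℝ := f - (c - f) - (c - f)^2

/-- The point of the plane with given `c = f + h` and `f`. -/
def levelPoint (c f : ℝ) : ℝ × ℝ :=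
  ((c - f + 1) * f / (levelD c f)^2, (levelD c f)^2 * (f - (c - f)^2) / f^2)

lemma levelT_eq (c : ℝ) {f : ℝ} (hf : f ≠ 0) : levelT c f = (c - f) * levelD c f / f := by
  simp only [levelT, levelD]; field_simp; ring

lemma levelPoint_spec {c f : ℝ} (hf : f ≠ 0) (hD : levelD c f ≠ 0) :
    pT (levelPoint c f).1 (levelPoint c f).2 = levelT c f ∧
      pH (levelPoint c f).1 (levelPoint c f).2 = c - f ∧
      pF (levelPoint c f).1 (levelPoint c f).2 = f := by
  have hT : pT (levelPoint c f).1 (levelPoint c f).2 = levelT c f := by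
    simp only [pT, levelPoint, levelT]; field_simp; ring
  have ha : (levelPoint c f).1 * levelT c f + 1 = f / levelD c f := by
    rw [levelT_eq c hf]; simp only [levelPoint]; field_simp; simp only [levelD]; ring
  have hb : (levelT c f)^2 + (levelPoint c f).2 = (levelD c f)^2 / f := by
    rw [levelT_eq c hf]; simp only [levelPoint]; field_simp; ring
  refine ⟨hT, ?_, ?_⟩
  · rw [pH, hT, ha, levelT_eq c hf]; field_simp
  · rw [pF, hT, ha, hb]; field_simp

lemma pinchuk_levelPoint {c f : ℝ} (hf : f ≠ 0) (hD : levelD c f ≠ 0) :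
    pinchuk (levelPoint c f) = (c, levelQ c f) := by
  obtain ⟨h1, h2, h3⟩ := levelPoint_spec hf hD
  simp only [pinchuk, h1, h2, h3, levelQ, add_sub_cancel]

lemma levelD_pF (v : ℝ × ℝ) : levelD (pinchuk v).1 (pF v.1 v.2) =
    (v.1 * pT v.1 v.2 + 1) * ((pT v.1 v.2)^2 + v.2) := by
  simp only [levelD, pinchuk, pF, pH, pT]; ring

lemma levelD_pF_ne_zero {v : ℝ × ℝ} (hf : pF v.1 v.2 ≠ 0) :
    levelD (pinchuk v).1 (pF v.1 v.2) ≠ 0 := by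
  rw [levelD_pF]
  intro h
  apply hf
  rw [pF, sq (v.1 * pT v.1 v.2 + 1), mul_assoc, h, mul_zero]

lemma levelPoint_pF {v : ℝ × ℝ} (hf : pF v.1 v.2 ≠ 0) :
    levelPoint (pinchuk v).1 (pF v.1 v.2) = v := by
  have hD := levelD_pF_ne_zero hf
  refine Prod.ext ?_ ?_
  · rw [levelPoint, div_eq_iff (pow_ne_zero 2 hD), levelD_pF]
    simp only [pinchuk, pF, pH, pT]; ring
  · rw [levelPoint, div_eq_iff (pow_ne_zero 2 hf), levelD_pF]
    simp only [pinchuk, pF, pH, pT]; ring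

lemma pinchuk_snd_eq_levelQ {v : ℝ × ℝ} (hf : pF v.1 v.2 ≠ 0) :
    (pinchuk v).2 = levelQ (pinchuk v).1 (pF v.1 v.2) := by
  conv_lhs => rw [← levelPoint_pF hf, pinchuk_levelPoint hf (levelD_pF_ne_zero hf)]

lemma hasDerivAt_levelQ (c : ℝ) {f : ℝ} (hf : f ≠ 0) :
    HasDerivAt (levelQ c)
      (((levelT c f)^2 + (levelT c f + f * (13 + 15 * (c - f)))^2 + f^2) / f) f := by
  have hh : HasDerivAt (fun f : ℝ => c - f) (-1) f := by
    simpa using (hasDerivAt_id f).const_sub c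
  have hi := hasDerivAt_id' f
  have hT : HasDerivAt (levelT c) _ f :=
    hh.sub (((hh.pow 2).mul (hh.add_const 1)).div hi hf)
  have hU : HasDerivAt (fun f => pU f (c - f)) _ f :=
    (hi.const_mul (1/4)).mul
      (((((((((hi.pow 3).const_mul 75).add (((hi.pow 2).const_mul 300).mul hh)).add
        ((hi.const_mul 450).mul (hh.pow 2))).add ((hi.pow 2).const_mul 276)).add
        ((hi.const_mul 828).mul hh)).add ((hh.pow 2).const_mul 48)).add (hi.const_mul 364)).add
        (hh.const_mul 48))
  have hQ : HasDerivAt (levelQ c) _ f :=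
    ((hT.pow 2).neg.sub (((hT.const_mul 6).mul hh).mul (hh.add_const 1))).add hU
  convert hQ using 1
  simp only [levelT, Pi.pow_apply, Pi.mul_apply]
  push_cast
  field_simp
  ring

lemma strictMonoOn_levelQ (c : ℝ) {ε : ℝ} (hε : ε ≠ 0) :
    StrictMonoOn (fun r => levelQ c (ε * r)) (Set.Ioi 0) := by
  have hd : ∀ r ∈ Set.Ioi (0 : ℝ), HasDerivAt (fun r => levelQ c (ε * r))
      (((levelT c (ε * r))^2 + (levelT c (ε * r) + ε * r * (13 + 15 * (c - ε * r)))^2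
        + (ε * r)^2) / (ε * r) * (ε * 1)) r := fun r hr =>
    (hasDerivAt_levelQ c (mul_ne_zero hε (ne_of_gt hr))).comp r
      ((hasDerivAt_id' r).const_mul ε)
  refine strictMonoOn_of_deriv_pos (convex_Ioi 0)
    (fun r hr => (hd r hr).continuousAt.continuousWithinAt) fun r hr => ?_
  rw [interior_Ioi] at hr
  have hr' : 0 < r := hr
  rw [(hd r hr).deriv]
  have e : ∀ A : ℝ, A / (ε * r) * (ε * 1) = A / r := fun A => by field_simp
  rw [e]
  have : 0 < (ε * r)^2 := by positivity
  positivity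

lemma levelD_Phi (s f : ℝ) :
    levelD (s^2 + 2*s) f = (f - (s^2 + s)) * ((s + 1) * (s + 2) - f) := by
  simp only [levelD]; ring

lemma levelQ_of_levelD_eq_zero {c f : ℝ} (hf : f ≠ 0) (hD : levelD c f = 0) :
    levelQ c f = pU f (c - f) := by
  simp [levelQ, levelT_eq c hf, hD]

lemma levelQ_self {s : ℝ} (hs : s^2 + s ≠ 0) :
    levelQ (s^2 + 2*s) (s^2 + s) = (Phi s).2 := by
  rw [levelQ_of_levelD_eq_zero hs (by rw [levelD_Phi]; ring), Phi]
  ring_nf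

lemma levelD_ne_zero {s f : ℝ} (hs : s ≠ -1) (hf : f ≠ 0) (hne : f ≠ s^2 + s)
    (hQ : levelQ (s^2 + 2*s) f = (Phi s).2) : levelD (s^2 + 2*s) f ≠ 0 := by
  intro hD
  have hQ' := levelQ_of_levelD_eq_zero hf hD
  rw [levelD_Phi] at hD
  rcases mul_eq_zero.1 hD with h | h
  · exact hne (by linarith)
  · have hf' : f = (-2 - s)^2 + (-2 - s) := by linarith
    have e : pU f (s^2 + 2*s - f) = (Phi (-2 - s)).2 := by
      rw [hf', Phi]; ring_nf
    rw [hQ, e, Phi_snd_eq, Phi_snd_eq] at hQ'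
    have e2 : (-2 - s)^2 + 2*(-2 - s) = s^2 + 2*s := by ring
    rw [e2] at hQ'
    have h0 : (s + 1) * phiOdd (s^2 + 2*s) = 0 := by linarith
    rcases mul_eq_zero.1 h0 with h1 | h1
    · exact hs (by linarith)
    · exact (phiOdd_neg hs).ne h1

lemma levelQ_zero_pos {f : ℝ} (hf : f ≠ 0) : 0 < levelQ 0 f := by
  have e : levelQ 0 f = f^2 * (63 - 104 * f + 197/4 * f^2) := by
    simp only [levelQ, levelT, pU]; field_simp; ring
  rw [e]
  have : 0 < f^2 := by positivity
  have : 0 < 63 - 104 * f + 197/4 * f^2 := by nlinarith [sq_nonneg (f - 208/197)]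
  positivity

lemma levelQ_neg_one_pos {f : ℝ} (hf : f ≠ 0) : 0 < levelQ (-1) f := by
  have e : levelQ (-1) f = f^2 * (197/4 * f^2 + 10 * f + 3/2) := by
    simp only [levelQ, levelT, pU]; field_simp; ring
  rw [e]
  have : 0 < f^2 := by positivity
  have : 0 < 197/4 * f^2 + 10 * f + 3/2 := by nlinarith [sq_nonneg (f + 20/197)]
  positivity

lemma pF_ne_zero_of_pinchuk_eq_Phi {v : ℝ × ℝ} {s : ℝ} (h : pinchuk v = Phi s) :
    pF v.1 v.2 ≠ 0 := by
  intro hf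
  have h1 : (pinchuk v).1 = s^2 + 2*s := by rw [h, Phi]
  have h2 : (pinchuk v).2 = pU (s^2 + s) s := by rw [h, Phi]
  simp only [pinchuk, hf, zero_add] at h1 h2
  rw [show pU 0 (pH v.1 v.2) = 0 by simp [pU], add_zero] at h2
  have hf' := hf
  rw [pF] at hf'
  rcases mul_eq_zero.1 hf' with ha | hb
  · have ha := pow_eq_zero_iff (two_ne_zero) |>.1 ha
    have hH : pH v.1 v.2 = 0 := by rw [pH, ha, mul_zero]
    have ht : pT v.1 v.2 ≠ 0 := by intro h; rw [h] at ha; norm_num at ha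
    have : 0 < (pT v.1 v.2)^2 := by positivity
    rw [hH] at h1 h2
    have hs : s * (s + 2) = 0 := by linarith
    rcases mul_eq_zero.1 hs with hs | hs
    · rw [hs] at h2; norm_num [pU] at h2; exact ht h2
    · rw [show s = -2 by linarith] at h2; norm_num [pU] at h2; linarith
  · have hH : pH v.1 v.2 = -1 := by
      have : v.1 * ((pT v.1 v.2)^2 + v.2) = pH v.1 v.2 + 1 := by
        simp only [pH, pT]; ring
      rw [hb] at this; linarith
    have ht : pT v.1 v.2 ≠ 0 := by intro h; rw [pH, h] at hH; norm_num at hH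
    rw [hH] at h1 h2
    have hs : s = -1 := by
      have : (s + 1)^2 = 0 := by linarith
      have := pow_eq_zero_iff (two_ne_zero) |>.1 this
      linarith
    rw [hs] at h2; norm_num [pU] at h2; exact ht h2

/-- Above a point `Phi s`, the sign of `f` is opposite to that of `s ^ 2 + s`. -/
lemma pF_mul_neg_of_pinchuk_eq_Phi {v : ℝ × ℝ} {s : ℝ} (h : pinchuk v = Phi s) :
    pF v.1 v.2 * (s^2 + s) < 0 := by
  have hf := pF_ne_zero_of_pinchuk_eq_Phi h
  have hD := levelD_pF_ne_zero hf
  have hQ := pinchuk_snd_eq_levelQ hf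
  have h1 : (pinchuk v).1 = s^2 + 2*s := by rw [h, Phi]
  rw [h1] at hD hQ
  rw [h] at hQ
  by_contra! hc
  have hs : s^2 + s ≠ 0 := by
    intro h0
    have h0' : s * (s + 1) = 0 := by linarith
    rcases mul_eq_zero.1 h0' with hs | hs
    · have := levelQ_zero_pos hf
      rw [hs] at hQ; norm_num [Phi, pU] at hQ; linarith
    · have := levelQ_neg_one_pos hf
      rw [show s = -1 by linarith] at hQ; norm_num [Phi, pU] at hQ; linarith
  have hpos : 0 < (s^2 + s) * pF v.1 v.2 := by
    rw [mul_comm]; exact lt_of_le_of_ne hc (mul_ne_zero hf hs).symm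
  have hr : 0 < pF v.1 v.2 / (s^2 + s) := by
    rcases pos_and_pos_or_neg_and_neg_of_mul_pos hpos with ⟨a, b⟩ | ⟨a, b⟩
    · exact div_pos b a
    · exact div_pos_of_neg_of_neg b a
  have heq : pF v.1 v.2 / (s^2 + s) = 1 := by
    refine (strictMonoOn_levelQ (s^2 + 2*s) hs).injOn hr (Set.mem_Ioi.2 one_pos) ?_
    simp only [mul_one]
    rw [mul_div_cancel₀ _ hs, levelQ_self hs, ← hQ]
  rw [div_eq_one_iff_eq hs] at heq
  rw [levelD_Phi, heq] at hD
  simp at hD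

lemma exists_levelQ_eq {ε s : ℝ} (hε : ε = 1 ∨ ε = -1) (hs : ε * (s^2 + s) < 0) :
    ∃ r, 0 < r ∧ levelQ (s^2 + 2*s) (ε * r) = (Phi s).2 := by
  have hε0 : ε ≠ 0 := by rcases hε with h | h <;> rw [h] <;> norm_num
  have hε2 : ε^2 = 1 := by rcases hε with h | h <;> rw [h] <;> norm_num
  set c := s^2 + 2*s with hc
  set W := (Phi s).2 with hW
  have hcont : ContinuousOn (fun r => levelQ c (ε * r)) (Set.Ioi 0) := fun r hr =>
    ((hasDerivAt_levelQ c (mul_ne_zero hε0 (ne_of_gt hr))).continuousAt.comp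
      (continuous_const_mul ε).continuousAt).continuousWithinAt
  have hsmall : ∃ r ∈ Set.Ioi (0 : ℝ), levelQ c (ε * r) ≤ W := by
    by_cases hc0 : c = 0
    · have hs' : s * (s + 2) = 0 := by rw [← hc0, hc]; ring
      rcases mul_eq_zero.1 hs' with h0 | h0
      · rw [h0] at hs; norm_num at hs
      · have h2 : s = -2 := by linarith
        have hε1 : ε = -1 := by
          rcases hε with h | h
          · rw [h, h2] at hs; norm_num at hs
          · exact h
        refine ⟨1/2, by norm_num, ?_⟩
        rw [hc0, hW, hε1, h2]
        norm_num [levelQ, levelT, Phi, pU]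
    · have hc1 : c + 1 ≠ 0 := by
        intro h
        have : (s + 1)^2 = 0 := by rw [← h, hc]; ring
        have := pow_eq_zero_iff (two_ne_zero) |>.1 this
        rw [show s = -1 by linarith] at hs; norm_num at hs
      let m : ℝ → ℝ := fun f =>
        -((c - f) * f - (c - f)^2 * (c - f + 1))^2
          - 6 * ((c - f) * f - (c - f)^2 * (c - f + 1)) * f * (c - f) * (c - f + 1)
          + f^2 * (pU f (c - f) - W)
      have hm : Continuous fun r => m (ε * r) := by
        simp only [m, pU]; fun_prop
      have hm0 : m (ε * 0) < 0 := by
        have : 0 < (c^2 * (c + 1))^2 := by positivity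
        simp only [m]; ring_nf at this ⊢; linarith
      obtain ⟨r, hr, hr0⟩ := ((hm.tendsto 0).eventually (gt_mem_nhds hm0)).filter_mono
        (nhdsWithin_le_nhds (s := Set.Ioi 0)) |>.and self_mem_nhdsWithin |>.exists
      refine ⟨r, hr0, ?_⟩
      have hf : ε * r ≠ 0 := mul_ne_zero hε0 (ne_of_gt hr0)
      have e : m (ε * r) = (ε * r)^2 * (levelQ c (ε * r) - W) := by
        generalize ε * r = f at hf
        simp only [m, levelQ, levelT]; field_simp
        ring
      rw [e] at hr
      have := neg_of_mul_neg_right hr (sq_nonneg _)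
      linarith
  have hlarge : ∃ r ∈ Set.Ioi (0 : ℝ), W ≤ levelQ c (ε * r) := by
    let m : ℝ → ℝ := fun z =>
      -(z * (c * z - ε) - ε * (c * z - ε)^2 * (c * z - ε + z))^2
        - 6 * (z * (c * z - ε) - ε * (c * z - ε)^2 * (c * z - ε + z)) * (c * z - ε)
          * (c * z - ε + z)
        + (1/4) * ε * (75*ε^3 + 300*ε^2*(c * z - ε) + 450*ε*(c * z - ε)^2
          + z * (276*ε^2 + 828*ε*(c * z - ε) + 48*(c * z - ε)^2)
          + z^2 * (364*ε + 48*(c * z - ε))) - z^4 * W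
    have hm : Continuous m := by
      simp only [m]; fun_prop
    have hm0 : 0 < m 0 := by
      simp only [m]; rcases hε with h | h <;> rw [h] <;> norm_num
    obtain ⟨z, hz, hz0⟩ := ((hm.tendsto 0).eventually (lt_mem_nhds hm0)).filter_mono
      (nhdsWithin_le_nhds (s := Set.Ioi 0)) |>.and self_mem_nhdsWithin |>.exists
    have hz0' : 0 < z := hz0
    refine ⟨z⁻¹, inv_pos.2 hz0', ?_⟩
    have e : m z = z^4 * (levelQ c (ε * z⁻¹) - W) := by
      simp only [m, levelQ, levelT, pU]
      rcases hε with h | h <;> rw [h] <;> field_simp <;> ring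
    rw [e] at hz
    have := pos_of_mul_pos_right hz (by positivity)
    linarith
  obtain ⟨r₁, h₁, h₁'⟩ := hsmall
  obtain ⟨r₂, h₂, h₂'⟩ := hlarge
  obtain ⟨r, hr, hr'⟩ := isPreconnected_Ioi.intermediate_value h₁ h₂ hcont ⟨h₁', h₂'⟩
  exact ⟨r, hr, hr'⟩

/-- The positive zero of a strictly increasing function depends continuously on parameters. -/
lemma continuousOn_of_strictMonoOn_zero {X : Type*} [TopologicalSpace X] {K : Set X}
    {R : X → ℝ → ℝ} {g : X → ℝ} (hmono : ∀ s ∈ K, StrictMonoOn (R s) (Set.Ioi 0))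
    (hR : ∀ r ∈ Set.Ioi (0 : ℝ), ContinuousOn (fun s => R s r) K)
    (hg : ∀ s ∈ K, 0 < g s ∧ R s (g s) = 0) : ContinuousOn g K := by
  intro s₀ hs₀
  obtain ⟨h0, h1⟩ := hg s₀ hs₀
  refine tendsto_order.2 ⟨fun a ha => ?_, fun b hb => ?_⟩
  · obtain ⟨a', ha', ha''⟩ := exists_between (max_lt ha h0)
    have hpos : 0 < a' := (le_max_right _ _).trans_lt ha'
    have hneg : R s₀ a' < 0 := h1 ▸ hmono s₀ hs₀ hpos h0 ha''
    filter_upwards [(hR a' hpos s₀ hs₀).eventually (gt_mem_nhds hneg), self_mem_nhdsWithin]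
      with s hs hsK
    refine ((le_max_left _ _).trans_lt ha').trans ?_
    rw [← (hg s hsK).2] at hs
    exact (hmono s hsK).lt_iff_lt hpos (hg s hsK).1 |>.1 hs
  · have hpos : 0 < b := h0.trans hb
    have hneg : 0 < R s₀ b := h1 ▸ hmono s₀ hs₀ h0 hpos hb
    filter_upwards [(hR b hpos s₀ hs₀).eventually (lt_mem_nhds hneg), self_mem_nhdsWithin]
      with s hs hsK
    rw [← (hg s hsK).2] at hs
    exact (hmono s hsK).lt_iff_lt (hg s hsK).1 hpos |>.1 hs

lemma exists_pinchuk_eq_Phi {ε s : ℝ} (hε : ε = 1 ∨ ε = -1) (hs : ε * (s^2 + s) < 0) :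
    ∃ v, pinchuk v = Phi s := by
  have hε0 : ε ≠ 0 := by rcases hε with h | h <;> rw [h] <;> norm_num
  obtain ⟨r, hr, hQ⟩ := exists_levelQ_eq hε hs
  have hf : ε * r ≠ 0 := mul_ne_zero hε0 hr.ne'
  have hs1 : s ≠ -1 := by rintro rfl; norm_num at hs
  refine ⟨levelPoint (s^2 + 2*s) (ε * r), ?_⟩
  rw [pinchuk_levelPoint hf (levelD_ne_zero hs1 hf ?_ hQ), hQ]
  · rfl
  · intro h
    rw [← h, ← mul_assoc] at hs
    have : 0 < ε * ε := mul_self_pos.2 hε0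
    exact hs.not_gt (mul_pos this hr)

lemma isPreconnected_preimage_Phi_image {ε : ℝ} (hε : ε = 1 ∨ ε = -1) {K : Set ℝ}
    (hK : IsPreconnected K) (hs : ∀ s ∈ K, ε * (s^2 + s) < 0) :
    IsPreconnected (pinchuk ⁻¹' (Phi '' K)) := by
  have hε0 : ε ≠ 0 := by rcases hε with h | h <;> rw [h] <;> norm_num
  have hεε : ε * ε = 1 := by rcases hε with h | h <;> rw [h] <;> norm_num
  have hex : ∀ s ∈ K, ∃ r, 0 < r ∧ levelQ (s^2 + 2*s) (ε * r) = (Phi s).2 := fun s h =>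
    exists_levelQ_eq hε (hs s h)
  choose! g hg0 hgQ using hex
  have hmono := fun s => strictMonoOn_levelQ (s^2 + 2*s) hε0
  have hgf : ∀ s ∈ K, ε * g s ≠ 0 := fun s h => mul_ne_zero hε0 (hg0 s h).ne'
  have hgD : ∀ s ∈ K, levelD (s^2 + 2*s) (ε * g s) ≠ 0 := by
    intro s h
    refine levelD_ne_zero ?_ (hgf s h) ?_ (hgQ s h)
    · rintro rfl; have := hs _ h; norm_num at this
    · intro h'
      have := hs s h
      rw [← h', ← mul_assoc, hεε, one_mul] at this
      exact this.not_gt (hg0 s h)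
  have hgc : ContinuousOn g K := by
    refine continuousOn_of_strictMonoOn_zero
      (R := fun s r => levelQ (s^2 + 2*s) (ε * r) - (Phi s).2) (fun s _ a ha b hb hab => ?_)
      (fun r _ => ?_) (fun s h => ⟨hg0 s h, sub_eq_zero.2 (hgQ s h)⟩)
    · exact sub_lt_sub_right (hmono s ha hb hab) _
    · refine Continuous.continuousOn ?_
      simp only [levelQ, levelT, pU, Phi]
      fun_prop
  have hγ : ContinuousOn (fun s => levelPoint (s^2 + 2*s) (ε * g s)) K := by
    simp only [levelPoint]
    have hDc : ContinuousOn (fun s => levelD (s^2 + 2*s) (ε * g s)) K := by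
      simp only [levelD]; fun_prop
    refine ContinuousOn.prodMk (ContinuousOn.div (by fun_prop) (by fun_prop) ?_)
      (ContinuousOn.div (by fun_prop) (by fun_prop) ?_)
    · exact fun s h => pow_ne_zero 2 (hgD s h)
    · exact fun s h => pow_ne_zero 2 (hgf s h)
  convert hK.image _ hγ using 1
  ext v
  constructor
  · rintro ⟨s, h, hv⟩
    refine ⟨s, h, ?_⟩
    have hf := pF_ne_zero_of_pinchuk_eq_Phi hv.symm
    have hsgn := pF_mul_neg_of_pinchuk_eq_Phi hv.symm
    have hQ := pinchuk_snd_eq_levelQ hf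
    have h1 : (pinchuk v).1 = s^2 + 2*s := by rw [← hv, Phi]
    have hr : 0 < ε * pF v.1 v.2 := by
      have h2 := hs s h
      by_contra! h3
      nlinarith [mul_nonneg_of_nonpos_of_nonpos h3 h2.le]
    have heq : g s = ε * pF v.1 v.2 := by
      refine (hmono s).injOn (hg0 s h) hr ?_
      rw [hgQ s h, ← mul_assoc, hεε, one_mul, ← h1, ← hQ, hv]
    simp only
    rw [heq, ← mul_assoc, hεε, one_mul, ← h1, levelPoint_pF hf]
  · rintro ⟨s, h, rfl⟩
    refine ⟨s, h, ?_⟩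
    rw [pinchuk_levelPoint (hgf s h) (hgD s h), hgQ s h]
    rfl

lemma Nat.card_connectedComponents_eq_ncard_range {X Y : Type*} [TopologicalSpace X]
    [TopologicalSpace Y] [TotallyDisconnectedSpace Y] {φ : X → Y} (hφ : Continuous φ)
    (hfib : ∀ y, IsPreconnected (φ ⁻¹' {y})) :
    Nat.card (ConnectedComponents X) = (Set.range φ).ncard := by
  have hinj : Function.Injective hφ.connectedComponentsLift := by
    intro a b hab
    obtain ⟨x, rfl⟩ := ConnectedComponents.surjective_coe a
    obtain ⟨y, rfl⟩ := ConnectedComponents.surjective_coe b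
    rw [hφ.connectedComponentsLift_apply_coe, hφ.connectedComponentsLift_apply_coe] at hab
    rw [ConnectedComponents.coe_eq_coe']
    exact (hfib (φ y)).subset_connectedComponent (x := y) rfl hab
  have hr : Set.range φ = Set.range hφ.connectedComponentsLift := by
    conv_lhs => rw [← hφ.connectedComponentsLift_comp_coe]
    exact ConnectedComponents.surjective_coe.range_comp _
  rw [hr, ← Nat.card_coe_set_eq, Nat.card_range_of_injective hinj]

lemma continuous_pinchuk : Continuous pinchuk := by
  unfold pinchuk pF pH pT pU; fun_prop

lemma pinchuk_snd_sub_phiEven {v : ℝ × ℝ} {s : ℝ} (h : pinchuk v = Phi s) :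
    (pinchuk v).2 - phiEven (pinchuk v).1 = (s + 1) * phiOdd (s^2 + 2*s) := by
  rw [h, Phi_snd_eq]; simp only [Phi]; ring

lemma pinchuk_snd_sub_phiEven_ne_zero {v : ℝ × ℝ} {s : ℝ} (h : pinchuk v = Phi s) :
    (pinchuk v).2 - phiEven (pinchuk v).1 ≠ 0 := by
  have hs : s ≠ -1 := by
    rintro rfl
    have := pF_mul_neg_of_pinchuk_eq_Phi h
    norm_num at this
  rw [pinchuk_snd_sub_phiEven h]
  exact mul_ne_zero (fun h => hs (by linarith)) (phiOdd_neg hs).ne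

/-- The signs that tell the three components apart. -/
def signPair (v : ℝ × ℝ) : SignType × SignType :=
  (SignType.sign (pF v.1 v.2), SignType.sign ((pinchuk v).2 - phiEven (pinchuk v).1))

lemma signPair_cases {v : ℝ × ℝ} {s : ℝ} (h : pinchuk v = Phi s) :
    (s < -1 ∧ signPair v = (-1, 1)) ∨ (s ∈ Set.Ioo (-1) 0 ∧ signPair v = (1, -1)) ∨
      (0 < s ∧ signPair v = (-1, -1)) := by
  have hsgn := pF_mul_neg_of_pinchuk_eq_Phi h
  have hs1 : s ≠ -1 := by rintro rfl; norm_num at hsgn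
  have hs0 : s ≠ 0 := by rintro rfl; norm_num at hsgn
  have hO := phiOdd_neg hs1
  simp only [signPair, pinchuk_snd_sub_phiEven h, Prod.mk.injEq]
  rcases lt_or_gt_of_ne hs1 with h1 | h1
  · refine Or.inl ⟨h1, sign_neg ?_, sign_pos (mul_pos_of_neg_of_neg (by linarith) hO)⟩
    exact neg_of_mul_neg_left hsgn (by nlinarith)
  · have h2 : SignType.sign ((s + 1) * phiOdd (s^2 + 2*s)) = -1 :=
      sign_neg (mul_neg_of_pos_of_neg (by linarith) hO)
    rcases lt_or_gt_of_ne hs0 with h3 | h3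
    · refine Or.inr (Or.inl ⟨⟨h1, h3⟩, sign_pos ?_, h2⟩)
      exact pos_of_mul_neg_left hsgn (by nlinarith)
    · refine Or.inr (Or.inr ⟨h3, sign_neg ?_, h2⟩)
      exact neg_of_mul_neg_left hsgn (by nlinarith)

lemma isPreconnected_signPair_fiber (y : SignType × SignType) :
    IsPreconnected (pinchuk ⁻¹' Set.range Phi ∩ signPair ⁻¹' {y}) := by
  have key : ∀ (K : Set ℝ) (ε : ℝ), (ε = 1 ∨ ε = -1) → IsPreconnected K →
      (∀ s ∈ K, ε * (s^2 + s) < 0) →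
      (∀ v s, pinchuk v = Phi s → (signPair v = y ↔ s ∈ K)) →
      IsPreconnected (pinchuk ⁻¹' Set.range Phi ∩ signPair ⁻¹' {y}) := by
    intro K ε hε hK hs hy
    convert isPreconnected_preimage_Phi_image hε hK hs using 1
    ext v
    constructor
    · rintro ⟨⟨s, hv⟩, hvy⟩
      exact ⟨s, (hy v s hv.symm).1 hvy, hv⟩
    · rintro ⟨s, hsK, hv⟩
      exact ⟨⟨s, hv⟩, (hy v s hv.symm).2 hsK⟩
  by_cases h1 : y = (-1, 1)
  · refine key (Set.Iio (-1)) (-1) (Or.inr rfl) isPreconnected_Iio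
      (fun s hs => by have : s < -1 := hs; nlinarith) fun v s h => ?_
    rw [h1]
    rcases signPair_cases h with ⟨a, b⟩ | ⟨a, b⟩ | ⟨a, b⟩ <;> rw [b]
    · simpa using a
    · simpa using a.1.le
    · simpa using by linarith
  by_cases h2 : y = (1, -1)
  · refine key (Set.Ioo (-1) 0) 1 (Or.inl rfl) isPreconnected_Ioo
      (fun s hs => by nlinarith [hs.1, hs.2]) fun v s h => ?_
    rw [h2]
    rcases signPair_cases h with ⟨a, b⟩ | ⟨a, b⟩ | ⟨a, b⟩ <;> rw [b]
    · exact iff_of_false (by decide) fun h => by linarith [h.1]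
    · exact iff_of_true rfl a
    · exact iff_of_false (by decide) fun h => by linarith [h.2]
  by_cases h3 : y = (-1, -1)
  · refine key (Set.Ioi 0) (-1) (Or.inr rfl) isPreconnected_Ioi
      (fun s hs => by have : 0 < s := hs; nlinarith) fun v s h => ?_
    rw [h3]
    rcases signPair_cases h with ⟨a, b⟩ | ⟨a, b⟩ | ⟨a, b⟩ <;> rw [b]
    · exact iff_of_false (by decide) fun h => by linarith [Set.mem_Ioi.1 h]
    · exact iff_of_false (by decide) fun h => by linarith [Set.mem_Ioi.1 h, a.2]
    · exact iff_of_true rfl a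
  refine key ∅ 1 (Or.inl rfl) isPreconnected_empty (fun s hs => hs.elim) fun v s h => ?_
  refine iff_of_false (fun hy => ?_) (Set.notMem_empty s)
  rcases signPair_cases h with ⟨-, b⟩ | ⟨-, b⟩ | ⟨-, b⟩
  · exact h1 (hy ▸ b)
  · exact h2 (hy ▸ b)
  · exact h3 (hy ▸ b)

lemma continuous_signPair :
    Continuous fun v : ↥(pinchuk ⁻¹' Set.range Phi) => signPair v := by
  refine continuous_iff_continuousAt.2 fun v => ?_
  obtain ⟨s, hs⟩ := v.2
  have hf := pF_ne_zero_of_pinchuk_eq_Phi hs.symm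
  have hq := pinchuk_snd_sub_phiEven_ne_zero hs.symm
  have c1 : Continuous fun v : ↥(pinchuk ⁻¹' Set.range Phi) => pF v.1.1 v.1.2 := by
    unfold pF pT; fun_prop
  have c2 : Continuous fun v : ↥(pinchuk ⁻¹' Set.range Phi) =>
      (pinchuk v).2 - phiEven (pinchuk v).1 := by
    have hE : Continuous phiEven := by unfold phiEven; fun_prop
    exact (continuous_pinchuk.snd.sub (hE.comp continuous_pinchuk.fst)).comp
      continuous_subtype_val
  exact ((continuousAt_sign_of_ne_zero hf).comp
    (f := fun v : ↥(pinchuk ⁻¹' Set.range Phi) => pF v.1.1 v.1.2) c1.continuousAt).prodMk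
    ((continuousAt_sign_of_ne_zero hq).comp
      (f := fun v : ↥(pinchuk ⁻¹' Set.range Phi) => (pinchuk v).2 - phiEven (pinchuk v).1)
      c2.continuousAt)

lemma range_signPair :
    Set.range (fun v : ↥(pinchuk ⁻¹' Set.range Phi) => signPair v)
      = {(-1, 1), (1, -1), (-1, -1)} := by
  ext y
  constructor
  · rintro ⟨⟨v, s, hs⟩, rfl⟩
    rcases signPair_cases hs.symm with ⟨-, b⟩ | ⟨-, b⟩ | ⟨-, b⟩ <;> simp [b]
  · have key : ∀ {ε s : ℝ}, (ε = 1 ∨ ε = -1) → ε * (s^2 + s) < 0 →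
        ∃ v : ↥(pinchuk ⁻¹' Set.range Phi), pinchuk v = Phi s := fun hε hs => by
      obtain ⟨v, hv⟩ := exists_pinchuk_eq_Phi hε hs
      exact ⟨⟨v, _, hv.symm⟩, hv⟩
    rintro (rfl | rfl | rfl)
    · obtain ⟨v, hv⟩ := key (ε := -1) (s := -2) (Or.inr rfl) (by norm_num)
      refine ⟨v, ?_⟩
      rcases signPair_cases hv with ⟨a, b⟩ | ⟨a, b⟩ | ⟨a, b⟩
      · exact b
      · norm_num at a
      · norm_num at a
    · obtain ⟨v, hv⟩ := key (ε := 1) (s := -1/2) (Or.inl rfl) (by norm_num)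
      refine ⟨v, ?_⟩
      rcases signPair_cases hv with ⟨a, b⟩ | ⟨a, b⟩ | ⟨a, b⟩
      · norm_num at a
      · exact b
      · norm_num at a
    · obtain ⟨v, hv⟩ := key (ε := -1) (s := 1) (Or.inr rfl) (by norm_num)
      refine ⟨v, ?_⟩
      rcases signPair_cases hv with ⟨a, b⟩ | ⟨a, b⟩ | ⟨a, b⟩
      · norm_num at a
      · norm_num at a
      · exact b

lemma card_connectedComponents_pinchuk_preimage :
    Nat.card (ConnectedComponents ↥(pinchuk ⁻¹' (Set.range Phi))) = 3 := by
  rw [Nat.card_connectedComponents_eq_ncard_range continuous_signPair, range_signPair]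
  · rw [Set.ncard_eq_toFinset_card']; decide
  · intro y
    rw [← Topology.IsInducing.subtypeVal.isPreconnected_image]
    convert isPreconnected_signPair_fiber y using 1
    ext v
    constructor
    · rintro ⟨w, hw, rfl⟩
      exact ⟨w.2, hw⟩
    · rintro ⟨hv, hy⟩
      exact ⟨⟨v, hv⟩, hy, rfl⟩

/-- The regular equation of the preimage curve. -/
def curveEq (v : ℝ × ℝ) : ℝ :=
  ((pinchuk v).2 - phiEven (pinchuk v).1)^2 - ((pinchuk v).1 + 1) * (phiOdd (pinchuk v).1)^2

lemma mem_preimage_iff_curveEq {v : ℝ × ℝ} (hv : (pinchuk v).2 - phiEven (pinchuk v).1 ≠ 0) :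
    v ∈ pinchuk ⁻¹' Set.range Phi ↔ curveEq v = 0 := by
  constructor
  · rintro ⟨s, hs⟩
    rw [curveEq, pinchuk_snd_sub_phiEven hs.symm, ← hs]
    simp only [Phi]; ring
  · intro h
    have hpos : 0 < (pinchuk v).1 + 1 := by
      have h1 : 0 < ((pinchuk v).2 - phiEven (pinchuk v).1)^2 := by positivity
      rw [curveEq] at h
      exact pos_of_mul_pos_left (by linarith) (sq_nonneg (phiOdd (pinchuk v).1))
    have hsq := Real.sq_sqrt hpos.le
    have key : ∀ σ : ℝ, σ^2 = (pinchuk v).1 + 1 →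
        (pinchuk v).2 - phiEven (pinchuk v).1 = σ * phiOdd (pinchuk v).1 →
        v ∈ pinchuk ⁻¹' Set.range Phi := by
      intro σ h1 h2
      have h3 : (σ - 1)^2 + 2*(σ - 1) = (pinchuk v).1 := by linarith
      refine ⟨σ - 1, Prod.ext h3 ?_⟩
      rw [Phi_snd_eq, h3]; linarith
    have hfac : ((pinchuk v).2 - phiEven (pinchuk v).1)^2
        = (√((pinchuk v).1 + 1) * phiOdd (pinchuk v).1)^2 := by
      rw [mul_pow, hsq]; rw [curveEq] at h; linarith
    rcases sq_eq_sq_iff_eq_or_eq_neg.1 hfac with h' | h'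
    · exact key _ hsq h'
    · exact key (-√((pinchuk v).1 + 1)) (by rw [neg_sq, hsq]) (by rw [h', neg_mul])

lemma contDiff_curveEq : ContDiff ℝ (⊤ : ℕ∞) curveEq := by
  unfold curveEq phiEven phiOdd pinchuk pU pF pH pT
  fun_prop

lemma exists_hasDerivAt_curveEq (p q : ℝ) :
    ∃ k : ℝ, ∀ (P Q : ℝ → ℝ) (P' Q' x : ℝ), P x = p → Q x = q → HasDerivAt P P' x →
      HasDerivAt Q Q' x →
      HasDerivAt (fun x => (Q x - phiEven (P x))^2 - (P x + 1) * (phiOdd (P x))^2)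
        (2 * (q - phiEven p) * Q' + k * P') x := by
  have hE : DifferentiableAt ℝ phiEven p := by unfold phiEven; fun_prop
  have hO : DifferentiableAt ℝ phiOdd p := by unfold phiOdd; fun_prop
  refine ⟨-(2 * (q - phiEven p) * deriv phiEven p) - ((phiOdd p)^2
    + (p + 1) * (2 * phiOdd p * deriv phiOdd p)), fun P Q P' Q' x hp hq hP hQ => ?_⟩
  subst hp hq
  have h1 := hE.hasDerivAt.comp x hP
  have h2 := hO.hasDerivAt.comp x hP
  refine HasDerivAt.congr_deriv (((hQ.sub h1).pow 2).sub ((hP.add_const 1).mul (h2.pow 2))) ?_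
  simp
  ring

/-- The derivative of the second coordinate of Pinchuk's map in terms of those of `t`, `h`
and `f`. -/
def pinchukSndDeriv (t h f t' h' f' : ℝ) : ℝ :=
  (-2 * t - 6 * h * (h + 1)) * t'
    + (-6 * t * (2 * h + 1)
      + (1/4) * f * (300*f^2 + 900*f*h + 828*f + 96*h + 48)) * h'
    + (1/4) * (300*f^3 + 900*f^2*h + 900*f*h^2 + 828*f^2 + 1656*f*h + 48*h^2 + 728*f + 48*h) * f'

lemma hasDerivAt_pinchuk_snd {t h f : ℝ → ℝ} {t' h' f' x : ℝ} (ht : HasDerivAt t t' x)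
    (hh : HasDerivAt h h' x) (hf : HasDerivAt f f' x) :
    HasDerivAt (fun x => -(t x)^2 - 6 * t x * h x * (h x + 1) + pU (f x) (h x))
      (pinchukSndDeriv (t x) (h x) (f x) t' h' f') x := by
  have hU : HasDerivAt (fun x => pU (f x) (h x)) _ x :=
    (hf.const_mul (1/4)).mul
      (((((((((hf.pow 3).const_mul 75).add (((hf.pow 2).const_mul 300).mul hh)).add
        ((hf.const_mul 450).mul (hh.pow 2))).add ((hf.pow 2).const_mul 276)).add
        ((hf.const_mul 828).mul hh)).add ((hh.pow 2).const_mul 48)).add (hf.const_mul 364)).add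
        (hh.const_mul 48))
  refine HasDerivAt.congr_deriv
    (((ht.pow 2).neg.sub (((ht.const_mul 6).mul hh).mul (hh.add_const 1))).add hU) ?_
  simp only [Pi.pow_apply, Pi.mul_apply, pinchukSndDeriv]
  push_cast
  ring

lemma hasDerivAt_pT_fst (x y : ℝ) : HasDerivAt (fun x => pT x y) y x := by
  simpa [pT] using ((hasDerivAt_id' x).mul_const y).sub_const 1

lemma hasDerivAt_pT_snd (x y : ℝ) : HasDerivAt (fun y => pT x y) x y := by
  simpa [pT] using ((hasDerivAt_id' y).const_mul x).sub_const 1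

lemma hasDerivAt_pH_fst (x y : ℝ) : HasDerivAt (fun x => pH x y)
    (y * (x * pT x y + 1) + pT x y * (pT x y + x * y)) x := by
  have hT := hasDerivAt_pT_fst x y
  refine HasDerivAt.congr_deriv (hT.mul (((hasDerivAt_id' x).mul hT).add_const 1)) ?_
  simp

lemma hasDerivAt_pH_snd (x y : ℝ) : HasDerivAt (fun y => pH x y)
    (x * (x * pT x y + 1) + pT x y * (x * x)) y := by
  have hT := hasDerivAt_pT_snd x y
  exact hT.mul ((hT.const_mul x).add_const 1)

lemma hasDerivAt_pF_fst (x y : ℝ) : HasDerivAt (fun x => pF x y)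
    (2 * (x * pT x y + 1) * (pT x y + x * y) * ((pT x y)^2 + y)
      + (x * pT x y + 1)^2 * (2 * pT x y * y)) x := by
  have hT := hasDerivAt_pT_fst x y
  refine HasDerivAt.congr_deriv
    (((((hasDerivAt_id' x).mul hT).add_const 1).pow 2).mul ((hT.pow 2).add_const y)) ?_
  simp

lemma hasDerivAt_pF_snd (x y : ℝ) : HasDerivAt (fun y => pF x y)
    (2 * (x * pT x y + 1) * (x * x) * ((pT x y)^2 + y)
      + (x * pT x y + 1)^2 * (2 * pT x y * x + 1)) y := by
  have hT := hasDerivAt_pT_snd x y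
  refine HasDerivAt.congr_deriv
    ((((hT.const_mul x).add_const 1).pow 2).mul ((hT.pow 2).add (hasDerivAt_id' y))) ?_
  simp

lemma jacobian_identity {t h f tx ty hx hy fx fy : ℝ} (hrel : f * (h - t) = h^2 * (h + 1))
    (hht : hx * ty - hy * tx = h - t) (hft : fx * ty - fy * tx = -f + 2 * h + 3 * h^2)
    (hfh : fx * hy - fy * hx = -f) :
    (fx + hx) * pinchukSndDeriv t h f ty hy fy - (fy + hy) * pinchukSndDeriv t h f tx hx fx
      = t^2 + (t + f * (13 + 15 * h))^2 + f^2 := by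
  have e : (fx + hx) * pinchukSndDeriv t h f ty hy fy
      - (fy + hy) * pinchukSndDeriv t h f tx hx fx
      = pinchukSndDeriv t h f 1 0 0 * ((fx * ty - fy * tx) + (hx * ty - hy * tx))
        + (pinchukSndDeriv t h f 0 1 0 - pinchukSndDeriv t h f 0 0 1)
          * (fx * hy - fy * hx) := by
    simp only [pinchukSndDeriv]; ring
  rw [e, hht, hft, hfh]
  simp only [pinchukSndDeriv]
  linear_combination 18 * (h + 1) * hrel

lemma jacobian_pos (t : ℝ) {f : ℝ} (h : ℝ) (hf : f ≠ 0) :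
    0 < t^2 + (t + f * (13 + 15 * h))^2 + f^2 := by
  positivity

lemma fderiv_curveEq_ne_zero {v : ℝ × ℝ} (hf : pF v.1 v.2 ≠ 0)
    (hv : (pinchuk v).2 - phiEven (pinchuk v).1 ≠ 0) : fderiv ℝ curveEq v ≠ 0 := by
  intro h0
  obtain ⟨x, y⟩ := v
  obtain ⟨k, hk⟩ := exists_hasDerivAt_curveEq (pinchuk (x, y)).1 (pinchuk (x, y)).2
  have hd : HasFDerivAt curveEq (0 : ℝ × ℝ →L[ℝ] ℝ) (x, y) := by
    rw [← h0]
    exact (contDiff_curveEq.differentiable (by simp) (x, y)).hasFDerivAt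
  have hx0 : HasDerivAt (fun x => curveEq (x, y)) 0 x := by
    simpa [Function.comp_def] using
      hd.comp_hasDerivAt x ((hasDerivAt_id' x).prodMk (hasDerivAt_const x y))
  have hy0 : HasDerivAt (fun y => curveEq (x, y)) 0 y := by
    simpa [Function.comp_def] using
      hd.comp_hasDerivAt y ((hasDerivAt_const y x).prodMk (hasDerivAt_id' y))
  have hx1 := hx0.unique <| hk (fun x => (pinchuk (x, y)).1) (fun x => (pinchuk (x, y)).2) _ _ x
    rfl rfl ((hasDerivAt_pF_fst x y).add (hasDerivAt_pH_fst x y))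
    (hasDerivAt_pinchuk_snd (hasDerivAt_pT_fst x y) (hasDerivAt_pH_fst x y)
      (hasDerivAt_pF_fst x y))
  have hy1 := hy0.unique <| hk (fun y => (pinchuk (x, y)).1) (fun y => (pinchuk (x, y)).2) _ _ y
    rfl rfl ((hasDerivAt_pF_snd x y).add (hasDerivAt_pH_snd x y))
    (hasDerivAt_pinchuk_snd (hasDerivAt_pT_snd x y) (hasDerivAt_pH_snd x y)
      (hasDerivAt_pF_snd x y))
  have hJ := jacobian_identity (t := pT x y) (h := pH x y) (f := pF x y) (tx := y) (ty := x)
    (hx := y * (x * pT x y + 1) + pT x y * (pT x y + x * y))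
    (hy := x * (x * pT x y + 1) + pT x y * (x * x))
    (fx := 2 * (x * pT x y + 1) * (pT x y + x * y) * ((pT x y)^2 + y)
      + (x * pT x y + 1)^2 * (2 * pT x y * y))
    (fy := 2 * (x * pT x y + 1) * (x * x) * ((pT x y)^2 + y)
      + (x * pT x y + 1)^2 * (2 * pT x y * x + 1))
    (by simp only [pF, pH, pT]; ring) (by simp only [pH, pT]; ring)
    (by simp only [pF, pH, pT]; ring) (by simp only [pF, pT]; ring)
  have hpos := jacobian_pos (pT x y) (pH x y) hf
  rw [← hJ] at hpos
  refine hpos.ne' ((mul_eq_zero.1 ?_).resolve_left hv)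
  linear_combination
    -((2 * (x * pT x y + 1) * (pT x y + x * y) * ((pT x y)^2 + y)
      + (x * pT x y + 1)^2 * (2 * pT x y * y)
      + (y * (x * pT x y + 1) + pT x y * (pT x y + x * y))) / 2) * hy1
    + ((2 * (x * pT x y + 1) * (x * x) * ((pT x y)^2 + y)
      + (x * pT x y + 1)^2 * (2 * pT x y * x + 1)
      + (x * (x * pT x y + 1) + pT x y * (x * x))) / 2) * hx1

/-- The preimage `F⁻¹(C)` of the curve `C = Φ(ℝ)` under Pinchuk's map is a smooth
    curve having exactly three connected components. -/
theorem pinchuk_preimage_curve_smooth_three_components :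
    (∀ p ∈ pinchuk ⁻¹' (Set.range Phi),
        IsSmoothCurveAt (pinchuk ⁻¹' (Set.range Phi)) p) ∧
      Nat.card (ConnectedComponents ↥(pinchuk ⁻¹' (Set.range Phi))) = 3 := by
  refine ⟨fun p ⟨s, hs⟩ => ?_, card_connectedComponents_pinchuk_preimage⟩
  have hF : Continuous fun v : ℝ × ℝ => pF v.1 v.2 := by unfold pF pT; fun_prop
  have hE : Continuous phiEven := by unfold phiEven; fun_prop
  have hq : Continuous fun v => (pinchuk v).2 - phiEven (pinchuk v).1 :=
    continuous_pinchuk.snd.sub (hE.comp continuous_pinchuk.fst)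
  refine ⟨{v | pF v.1 v.2 ≠ 0 ∧ (pinchuk v).2 - phiEven (pinchuk v).1 ≠ 0},
    (isOpen_ne_fun hF continuous_const).inter (isOpen_ne_fun hq continuous_const),
    ⟨pF_ne_zero_of_pinchuk_eq_Phi hs.symm, pinchuk_snd_sub_phiEven_ne_zero hs.symm⟩,
    curveEq, contDiff_curveEq, fun v hv => fderiv_curveEq_ne_zero hv.1 hv.2, ?_⟩
  ext v
  exact ⟨fun h => ⟨h.2, (mem_preimage_iff_curveEq h.2.2).1 h.1⟩,
    fun h => ⟨(mem_preimage_iff_curveEq h.1.2).2 h.2, h.1⟩⟩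
end
end

section
/- Let ℂF : ℂ² → ℂ² be the complexification of Pinchuk's map. Then the set S_{ℂF} of points at which ℂF is not proper is exactly Φ(ℂ), the image of the complex curve Φ(s) = (s² + 2s, u(s² + s, s)) for s ∈ ℂ. -/
noncomputable section

/-- The complex Pinchuk auxiliary polynomial `t = xy - 1`. -/
def cT (x y : ℂ) : ℂ := x * y - 1

/-- The complex Pinchuk auxiliary polynomial `h = t(xt + 1)`. -/
def cH (x y : ℂ) : ℂ := cT x y * (x * cT x y + 1)

/-- The complex Pinchuk auxiliary polynomial `f = (xt+1)^2 (t^2 + y)`. -/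
def cF (x y : ℂ) : ℂ := (x * cT x y + 1) ^ 2 * ((cT x y) ^ 2 + y)

/-- The complex Pinchuk polynomial `u(f,h)`. -/
def cU (f h : ℂ) : ℂ :=
  (1/4) * f * (75*f^3 + 300*f^2*h + 450*f*h^2 + 276*f^2 + 828*f*h + 48*h^2 + 364*f + 48*h)

/-- The complexification `ℂF : ℂ² → ℂ²` of Pinchuk's map, given by the same
    polynomials `p = f + h` and `q = -t² - 6th(h+1) + u(f,h)`. -/
def cPinchuk : ℂ × ℂ → ℂ × ℂ := fun v =>
  (cF v.1 v.2 + cH v.1 v.2,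
   -(cT v.1 v.2)^2 - 6 * cT v.1 v.2 * cH v.1 v.2 * (cH v.1 v.2 + 1)
     + cU (cF v.1 v.2) (cH v.1 v.2))

/-- The complex parameterization `Φ(s) = (s² + 2s, u(s² + s, s))`. -/
def cPhi (s : ℂ) : ℂ × ℂ := (s^2 + 2*s, cU (s^2 + s) s)

lemma continuous_cPinchuk : Continuous cPinchuk := by
  unfold cPinchuk cU cF cH cT
  fun_prop

lemma tendsto_cU {X : Type*} {l : Filter X} {F H : X → ℂ} {f h : ℂ}
    (hF : Filter.Tendsto F l (nhds f)) (hH : Filter.Tendsto H l (nhds h)) :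
    Filter.Tendsto (fun v => cU (F v) (H v)) l (nhds (cU f h)) := by
  have hc : Continuous (Function.uncurry cU) := by
    simp only [Function.uncurry_def, cU]
    fun_prop
  simpa only [Function.comp_def, Function.uncurry_apply_pair] using
    (hc.tendsto (f, h)).comp (hF.prodMk_nhds hH)

lemma cF_mul_cH_sub_cT (x y : ℂ) :
    cF x y * (cH x y - cT x y) = cH x y ^ 2 * (cH x y + 1) := by
  unfold cF cH cT
  ring

lemma mul_cT_sq (x y : ℂ) : x * cT x y ^ 2 = cH x y - cT x y := by
  unfold cH cT
  ring

lemma mul_cF_sub (x y : ℂ) :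
    (x * cT x y + 1) * (cF x y - cH x y * (cH x y + 1)) = cF x y := by
  unfold cF cH cT
  ring

/-- If a continuous map into a regular space is not proper at `w`, some ultrafilter escapes to
infinity while its image converges to `w`. -/
lemma NotProperAt.exists_ultrafilter {X Y : Type*} [TopologicalSpace X] [TopologicalSpace Y]
    [RegularSpace Y] {g : X → Y} (hg : Continuous g) {w : Y} (hw : NotProperAt g w) :
    ∃ U : Ultrafilter X, (U : Filter X) ≤ Filter.cocompact X ∧
      Filter.Tendsto g U (nhds w) := by
  have hne : (Filter.cocompact X ⊓ Filter.comap g (nhds w)).NeBot := by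
    rw [Filter.neBot_iff]
    intro hbot
    rw [← disjoint_iff, Filter.disjoint_iff] at hbot
    obtain ⟨s, hs, t, ht, hst⟩ := hbot
    obtain ⟨K, hK, hKs⟩ := Filter.mem_cocompact.1 hs
    obtain ⟨V, hV, hVt⟩ := Filter.mem_comap.1 ht
    obtain ⟨C, hC, hCc, hCV⟩ := exists_mem_nhds_isClosed_subset hV
    refine hw ⟨C, hC, hK.of_isClosed_subset (isClosed_closure.preimage hg) fun v hv => ?_⟩
    rw [hCc.closure_eq] at hv
    by_contra hvK
    exact Set.disjoint_left.1 hst (hKs hvK) (hVt (hCV hv))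
  obtain ⟨U, hU⟩ := Ultrafilter.exists_le (Filter.cocompact X ⊓ Filter.comap g (nhds w))
  exact ⟨U, hU.trans inf_le_left, Filter.tendsto_iff_comap.2 (hU.trans inf_le_right)⟩

/-- Along an ultrafilter, a complex function converges or its inverse tends to `0`. -/
lemma Ultrafilter.tendsto_nhds_or_inv_tendsto_zero {X : Type*} (U : Ultrafilter X) (z : X → ℂ) :
    (∃ a, Filter.Tendsto z U (nhds a)) ∨
      (Filter.Tendsto (fun v => (z v)⁻¹) U (nhds 0) ∧ ∀ᶠ v in (U : Filter X), z v ≠ 0) := by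
  by_cases hz : Filter.Tendsto z U (Bornology.cobounded ℂ)
  · exact Or.inr ⟨Filter.tendsto_inv₀_cobounded.comp hz, hz.eventually_ne_cobounded 0⟩
  · left
    rw [Metric.cobounded_eq_cocompact, Filter.hasBasis_cocompact.tendsto_right_iff] at hz
    push Not at hz
    obtain ⟨K, hK, hzK⟩ := hz
    obtain ⟨a, -, ha⟩ := hK.ultrafilter_le_nhds' (U.map z)
      (hzK.mono fun v hv => not_not.1 hv)
    exact ⟨a, ha⟩

/-- The relation obtained by eliminating `t` between `f (h - t) = h² (h + 1)` and the formula for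
the second component, in terms of `k = 1 / h`. -/
lemma elimination_identity {p q f h t : ℂ} (hp : p = f + h)
    (hq : q = -t ^ 2 - 6 * t * h * (h + 1) + cU f h)
    (hrel : f * (h - t) = h ^ 2 * (h + 1)) (hh : h ≠ 0) :
    q * (p * h⁻¹ - 1) ^ 2 * h⁻¹ ^ 4 = -((p * h⁻¹ - 1) * h⁻¹ - 1 - h⁻¹) ^ 2
      - 6 * ((p * h⁻¹ - 1) * h⁻¹ - 1 - h⁻¹) * (p * h⁻¹ - 1) * (1 + h⁻¹)
      + (1 / 4) * (p * h⁻¹ - 1) ^ 3 * (75 * (p * h⁻¹ - 1) ^ 3 + 300 * (p * h⁻¹ - 1) ^ 2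
        + 450 * (p * h⁻¹ - 1) + h⁻¹ * (276 * (p * h⁻¹ - 1) ^ 2 + 828 * (p * h⁻¹ - 1) + 48)
        + h⁻¹ ^ 2 * (364 * (p * h⁻¹ - 1) + 48)) := by
  have hg : p * h⁻¹ - 1 = f * h⁻¹ := by
    rw [hp]
    field_simp
    ring
  have hT : f * h⁻¹ * h⁻¹ - 1 - h⁻¹ = t * f * h⁻¹ ^ 3 := by
    field_simp
    linear_combination hrel
  rw [hg, hT, hq, cU]
  field_simp
  ring

/-- If the Pinchuk map stays bounded along an ultrafilter, then `h` converges. -/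
lemma exists_tendsto_cH {U : Ultrafilter (ℂ × ℂ)} {w : ℂ × ℂ}
    (hp : Filter.Tendsto (fun v => (cPinchuk v).1) U (nhds w.1))
    (hq : Filter.Tendsto (fun v => (cPinchuk v).2) U (nhds w.2)) :
    ∃ a, Filter.Tendsto (fun v : ℂ × ℂ => cH v.1 v.2) U (nhds a) := by
  rcases U.tendsto_nhds_or_inv_tendsto_zero (fun v => cH v.1 v.2) with h | ⟨hk, hne⟩
  · exact h
  exfalso
  have hg := (hp.mul hk).sub_const 1
  have hT := ((hg.mul hk).sub_const 1).sub hk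
  have hL := (hq.mul (hg.pow 2)).mul (hk.pow 4)
  have hR := ((hT.pow 2).neg.sub (((hT.const_mul 6).mul hg).mul (hk.const_add 1))).add
    (((hg.pow 3).const_mul (1 / 4)).mul
      (((((hg.pow 3).const_mul 75).add ((hg.pow 2).const_mul 300)).add (hg.const_mul 450)).add
        (hk.mul ((((hg.pow 2).const_mul 276).add (hg.const_mul 828)).add_const 48)) |>.add
        ((hk.pow 2).mul ((hg.const_mul 364).add_const 48))))
  have key := tendsto_nhds_unique_of_eventuallyEq hL hR (hne.mono fun v hv =>
    elimination_identity rfl rfl (cF_mul_cH_sub_cT v.1 v.2) hv)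
  norm_num at key

/-- If the Pinchuk map and `h` stay bounded along an ultrafilter, then `t` converges. -/
lemma exists_tendsto_cT {U : Ultrafilter (ℂ × ℂ)} {q h u : ℂ}
    (hq : Filter.Tendsto (fun v => (cPinchuk v).2) U (nhds q))
    (hh : Filter.Tendsto (fun v : ℂ × ℂ => cH v.1 v.2) U (nhds h))
    (hu : Filter.Tendsto (fun v : ℂ × ℂ => cU (cF v.1 v.2) (cH v.1 v.2)) U (nhds u)) :
    ∃ b, Filter.Tendsto (fun v : ℂ × ℂ => cT v.1 v.2) U (nhds b) := by
  rcases U.tendsto_nhds_or_inv_tendsto_zero (fun v => cT v.1 v.2) with h | ⟨hk, hne⟩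
  · exact h
  exfalso
  have hL := (hq.sub hu).mul (hk.pow 2)
  have hR := ((hk.mul (hh.mul (hh.add_const 1))).const_mul (-6)).sub_const 1
  have key := tendsto_nhds_unique_of_eventuallyEq hL hR (hne.mono fun v hv => by
    have hv' : cT v.1 v.2 ≠ 0 := hv
    simp only [cPinchuk]
    field_simp
    ring)
  norm_num at key

lemma not_le_cocompact_of_tendsto {U : Ultrafilter (ℂ × ℂ)} {x y : ℂ}
    (hx : Filter.Tendsto (fun v : ℂ × ℂ => v.1) U (nhds x))
    (hy : Filter.Tendsto (fun v : ℂ × ℂ => v.2) U (nhds y)) :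
    ¬ (U : Filter (ℂ × ℂ)) ≤ Filter.cocompact (ℂ × ℂ) := by
  intro hU
  have hle : (U : Filter (ℂ × ℂ)) ≤ nhds (x, y) := hx.prodMk_nhds hy
  exact U.neBot.ne (le_bot_iff.1 ((le_inf hle hU).trans (disjoint_nhds_cocompact _).le_bot))

/-- If `f` and `t` converge and `xt + 1` tends to `1`, then `y` converges. -/
lemma tendsto_snd_of_tendsto_one {U : Filter (ℂ × ℂ)} {f t : ℂ}
    (hf : Filter.Tendsto (fun v : ℂ × ℂ => cF v.1 v.2) U (nhds f))
    (ht : Filter.Tendsto (fun v : ℂ × ℂ => cT v.1 v.2) U (nhds t))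
    (hA : Filter.Tendsto (fun v : ℂ × ℂ => v.1 * cT v.1 v.2 + 1) U (nhds 1)) :
    Filter.Tendsto (fun v : ℂ × ℂ => v.2) U (nhds (f - t ^ 2)) := by
  have h := (hf.div (hA.pow 2) (by norm_num)).sub (ht.pow 2)
  rw [one_pow, div_one] at h
  refine h.congr' ((hA.eventually_ne one_ne_zero).mono fun v hv => ?_)
  simp only [Pi.div_apply, cF]
  field_simp
  ring

/-- If `xy - 1` converges and `y` has a nonzero limit, then `x` converges. -/
lemma tendsto_fst_of_tendsto_snd {U : Filter (ℂ × ℂ)} {y t : ℂ}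
    (hy : Filter.Tendsto (fun v : ℂ × ℂ => v.2) U (nhds y)) (hy0 : y ≠ 0)
    (ht : Filter.Tendsto (fun v : ℂ × ℂ => cT v.1 v.2) U (nhds t)) :
    Filter.Tendsto (fun v : ℂ × ℂ => v.1) U (nhds ((t + 1) / y)) := by
  refine ((ht.add_const 1).div hy hy0).congr' ((hy.eventually_ne hy0).mono fun v hv => ?_)
  simp only [Pi.div_apply, cT]
  field_simp
  ring

/-- If `xy - 1` converges and `x` has a nonzero limit, then `y` converges. -/
lemma tendsto_snd_of_tendsto_fst {U : Filter (ℂ × ℂ)} {x t : ℂ}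
    (hx : Filter.Tendsto (fun v : ℂ × ℂ => v.1) U (nhds x)) (hx0 : x ≠ 0)
    (ht : Filter.Tendsto (fun v : ℂ × ℂ => cT v.1 v.2) U (nhds t)) :
    Filter.Tendsto (fun v : ℂ × ℂ => v.2) U (nhds ((t + 1) / x)) := by
  refine ((ht.add_const 1).div hx hx0).congr' ((hx.eventually_ne hx0).mono fun v hv => ?_)
  simp only [Pi.div_apply, cT]
  field_simp
  ring

lemma mem_range_cPhi_of_notProperAt {w : ℂ × ℂ} (hw : NotProperAt cPinchuk w) :
    w ∈ Set.range cPhi := by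
  obtain ⟨U, hU, hlim⟩ := hw.exists_ultrafilter continuous_cPinchuk
  have hp : Filter.Tendsto (fun v => (cPinchuk v).1) U (nhds w.1) :=
    (continuous_fst.tendsto w).comp hlim
  have hq : Filter.Tendsto (fun v => (cPinchuk v).2) U (nhds w.2) :=
    (continuous_snd.tendsto w).comp hlim
  obtain ⟨a, ha⟩ := exists_tendsto_cH hp hq
  obtain ⟨f, hf⟩ : ∃ f, Filter.Tendsto (fun v : ℂ × ℂ => cF v.1 v.2) U (nhds f) :=
    ⟨w.1 - a, (hp.sub ha).congr fun v => by simp [cPinchuk]⟩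
  have hu : Filter.Tendsto (fun v : ℂ × ℂ => cU (cF v.1 v.2) (cH v.1 v.2)) U (nhds (cU f a)) :=
    tendsto_cU hf ha
  obtain ⟨b, hb⟩ := exists_tendsto_cT hq ha hu
  have hw1 : w.1 = f + a := tendsto_nhds_unique hp (hf.add ha)
  have hw2 : w.2 = -b ^ 2 - 6 * b * a * (a + 1) + cU f a :=
    tendsto_nhds_unique_of_eventuallyEq hq
      (((hb.pow 2).neg.sub (((hb.const_mul 6).mul ha).mul (ha.add_const 1))).add hu)
      (.of_forall fun _ => rfl)
  have hrel : f * (a - b) = a ^ 2 * (a + 1) :=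
    tendsto_nhds_unique_of_eventuallyEq (hf.mul (ha.sub hb))
      ((ha.pow 2).mul (ha.add_const 1)) (.of_forall fun v => cF_mul_cH_sub_cT v.1 v.2)
  by_cases hb0 : b = 0
  · subst hb0
    suffices hfa : f = a ^ 2 + a by
      refine ⟨a, Prod.ext ?_ ?_⟩
      · rw [hw1, hfa, cPhi]
        ring
      · rw [hw2, hfa, cPhi]
        ring
    by_cases ha0 : a = 0
    · subst ha0
      by_contra hf0
      replace hf0 : f ≠ 0 := by simpa using hf0
      have hd := hf.sub (ha.mul (ha.add_const 1))
      rw [zero_mul, sub_zero] at hd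
      have hA : Filter.Tendsto (fun v : ℂ × ℂ => v.1 * cT v.1 v.2 + 1) U (nhds 1) := by
        have h := hf.div hd hf0
        rw [div_self hf0] at h
        refine h.congr' ((hd.eventually_ne hf0).mono fun v hv => ?_)
        exact (eq_div_of_mul_eq hv (mul_cF_sub v.1 v.2)).symm
      have hy := tendsto_snd_of_tendsto_one hf hb hA
      exact not_le_cocompact_of_tendsto
        (tendsto_fst_of_tendsto_snd hy (by simpa using hf0) hb) hy hU
    · refine mul_right_cancel₀ ha0 ?_
      linear_combination hrel
  · exfalso
    have hb2 : b ^ 2 ≠ 0 := pow_ne_zero 2 hb0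
    have hx : Filter.Tendsto (fun v : ℂ × ℂ => v.1) U (nhds ((a - b) / b ^ 2)) :=
      ((ha.sub hb).div (hb.pow 2) hb2).congr' (((hb.pow 2).eventually_ne hb2).mono fun v hv =>
        (eq_div_of_mul_eq hv (mul_cT_sq v.1 v.2)).symm)
    by_cases hx0 : (a - b) / b ^ 2 = 0
    · rw [hx0] at hx
      have hA := (hx.mul hb).add_const 1
      rw [zero_mul, zero_add] at hA
      exact not_le_cocompact_of_tendsto hx (tendsto_snd_of_tendsto_one hf hb hA) hU
    · exact not_le_cocompact_of_tendsto hx (tendsto_snd_of_tendsto_fst hx hx0 hb) hU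

/-- A curve of points which escapes to infinity as `e → 0`, along which `t`, `h` and `f` are
polynomials in `e`. -/
def escapingCurve (s e : ℂ) : ℂ × ℂ :=
  ((e ^ 2 * (s + e))⁻¹, e ^ 2 * (s + e) * (e * (s + e) + 1))

/-- The image of `escapingCurve` under the Pinchuk map. -/
def escapingCurveImage (s e : ℂ) : ℂ × ℂ :=
  let t := e * (s + e)
  let h := (s + e) * (1 + e)
  let f := (1 + e) ^ 2 * ((s + e) ^ 2 + (s + e) * (e * (s + e) + 1))
  (f + h, -t ^ 2 - 6 * t * h * (h + 1) + cU f h)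

lemma cPinchuk_escapingCurve {s e : ℂ} (he : e ≠ 0) (hr : s + e ≠ 0) :
    cPinchuk (escapingCurve s e) = escapingCurveImage s e := by
  have hT : cT (escapingCurve s e).1 (escapingCurve s e).2 = e * (s + e) := by
    simp only [cT, escapingCurve]
    field_simp
    ring
  have hH : cH (escapingCurve s e).1 (escapingCurve s e).2 = (s + e) * (1 + e) := by
    rw [cH, hT, escapingCurve]
    field_simp
  have hF : cF (escapingCurve s e).1 (escapingCurve s e).2 =
      (1 + e) ^ 2 * ((s + e) ^ 2 + (s + e) * (e * (s + e) + 1)) := by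
    rw [cF, hT, escapingCurve]
    field_simp
  simp only [cPinchuk, hT, hH, hF, escapingCurveImage]

lemma continuous_escapingCurveImage (s : ℂ) : Continuous (escapingCurveImage s) := by
  unfold escapingCurveImage cU
  fun_prop

lemma escapingCurveImage_zero (s : ℂ) : escapingCurveImage s 0 = cPhi s := by
  simp only [escapingCurveImage, cPhi, cU]
  ext <;> ring

lemma notProperAt_cPhi (s : ℂ) : NotProperAt cPinchuk (cPhi s) := by
  rintro ⟨V, hV, hK⟩
  obtain ⟨C, hC⟩ := hK.isBounded.exists_norm_le
  have hmem : ∀ᶠ e in nhds (0 : ℂ), escapingCurveImage s e ∈ V :=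
    (continuous_escapingCurveImage s).tendsto' 0 _ (escapingCurveImage_zero s) hV
  have hsmall : ∀ᶠ e in nhds (0 : ℂ), C * ‖e ^ 2 * (s + e)‖ < 1 := by
    have hc : Continuous fun e : ℂ => C * ‖e ^ 2 * (s + e)‖ := by fun_prop
    exact (hc.tendsto' 0 0 (by simp)).eventually_lt_const one_pos
  have hr : ∀ᶠ e in nhdsWithin (0 : ℂ) {0}ᶜ, s + e ≠ 0 := by
    by_cases hs : s = 0
    · filter_upwards [self_mem_nhdsWithin] with e he
      simpa [hs] using he
    · have hc : Continuous fun e : ℂ => s + e := by fun_prop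
      exact ((hc.tendsto' 0 s (by simp)).eventually_ne hs).filter_mono nhdsWithin_le_nhds
  obtain ⟨e, ⟨⟨heV, hlt⟩, hre⟩, he⟩ :=
    ((((hmem.and hsmall).filter_mono nhdsWithin_le_nhds).and hr).and
      self_mem_nhdsWithin).exists
  replace he : e ≠ 0 := he
  have hpos : 0 < ‖e ^ 2 * (s + e)‖ := norm_pos_iff.2 (mul_ne_zero (pow_ne_zero 2 he) hre)
  have hle : ‖(e ^ 2 * (s + e))⁻¹‖ ≤ C :=
    (norm_fst_le _).trans (hC (escapingCurve s e)
      (subset_closure ((cPinchuk_escapingCurve he hre).symm ▸ heV)))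
  rw [norm_inv, inv_le_iff_one_le_mul₀ hpos] at hle
  exact hlt.not_ge hle

/-- The set of points at which the complexified Pinchuk map `ℂF` is not proper is
    exactly the curve `Φ(ℂ)`. -/
theorem complex_pinchuk_not_proper_set_eq_curve :
    {w : ℂ × ℂ | NotProperAt cPinchuk w} = Set.range cPhi := by
  refine Set.Subset.antisymm (fun w hw => mem_range_cPhi_of_notProperAt hw) ?_
  rintro _ ⟨s, rfl⟩
  exact notProperAt_cPhi s
end
end
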